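/- arXiv:1511.06895 — 2 statements merged into one kernel-verified Lean document; each statement's English description precedes it below -/
import Mathlib

section
/- Let R > 0 and let μ = e^{-U(x)} dx be a probability measure on ℝⁿ with U smooth and Hess U(x) ≥ R·Id for all x. Then for every bounded smooth real-valued function f on ℝⁿ with bounded derivatives, ∫_{ℝⁿ} f² ln(f²) dμ − (∫_{ℝⁿ} f² dμ) · ln(∫_{ℝⁿ} f² dμ) ≤ (2/R) ∫_{ℝⁿ} ‖∇f‖² dμ (the log-Sobolev inequality of Bakry–Emery for uniformly log-concave measures). -/
open MeasureTheory Real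

section

open scoped ENNReal NNReal Pointwise

/-- One-dimensional Brunn–Minkowski inequality. -/
theorem volume_add_volume_le_of_add_subset {A B C : Set ℝ} (hA : MeasurableSet A)
    (hB : MeasurableSet B) (hA' : A.Nonempty) (hB' : B.Nonempty) (h : A + B ⊆ C) :
    volume A + volume B ≤ volume C := by
  obtain ⟨a, ha⟩ := hA'
  obtain ⟨b, hb⟩ := hB'
  have hAC : volume A ≤ volume C := by
    calc volume A = volume ((fun x => x + b) '' A) := by
          simp [Set.image_add_right, measure_preimage_add_right]
      _ ≤ volume C := measure_mono (by
          rintro _ ⟨x, hx, rfl⟩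
          exact h (Set.add_mem_add hx hb))
  have hBC : volume B ≤ volume C := by
    calc volume B = volume ((fun x => a + x) '' B) := by
          simp [Set.image_add_left, measure_preimage_add]
      _ ≤ volume C := measure_mono (by
          rintro _ ⟨x, hx, rfl⟩
          exact h (Set.add_mem_add ha hx))
  rcases eq_or_ne (volume A) 0 with hA0 | hA0
  · simpa [hA0] using hBC
  rcases eq_or_ne (volume B) 0 with hB0 | hB0
  · simpa [hB0] using hAC
  by_contra! hlt
  obtain ⟨p, hp, q, hq, hpq⟩ := ENNReal.exists_lt_add_of_lt_add hlt hA0 hB0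
  obtain ⟨K, hKA, hK, hpK⟩ := hA.exists_lt_isCompact hp
  obtain ⟨L, hLB, hL, hqL⟩ := hB.exists_lt_isCompact hq
  have hKne : K.Nonempty := nonempty_of_measure_ne_zero (ne_bot_of_gt hpK)
  have hLne : L.Nonempty := nonempty_of_measure_ne_zero (ne_bot_of_gt hqL)
  obtain ⟨M, hMK, hM⟩ := hK.exists_isGreatest hKne
  obtain ⟨m, hmL, hm⟩ := hL.exists_isLeast hLne
  have hd : AEDisjoint volume ((fun x => x + m) '' K) ((fun x => M + x) '' L) := by
    refine measure_mono_null (t := {M + m}) ?_ (by simp)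
    rintro _ ⟨⟨x, hx, rfl⟩, ⟨y, hy, hxy⟩⟩
    have h1 := hM hx
    have h2 := hm hy
    simp only [Set.mem_singleton_iff] at *
    linarith
  have hLm : NullMeasurableSet ((fun x => M + x) '' L) volume :=
    (hL.image (by fun_prop)).measurableSet.nullMeasurableSet
  have hle : volume K + volume L ≤ volume C := by
    calc volume K + volume L
        = volume ((fun x => x + m) '' K) + volume ((fun x => M + x) '' L) := by
          simp [Set.image_add_right, measure_preimage_add_right, Set.image_add_left,
            measure_preimage_add]
      _ = volume ((fun x => x + m) '' K ∪ (fun x => M + x) '' L) := (measure_union₀ hLm hd).symm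
      _ ≤ volume C := by
          refine measure_mono (Set.union_subset ?_ ?_)
          · rintro _ ⟨x, hx, rfl⟩
            exact h (Set.add_mem_add (hKA hx) (hLB hmL))
          · rintro _ ⟨x, hx, rfl⟩
            exact h (Set.add_mem_add (hKA hMK) (hLB hx))
  exact absurd (hpq.trans_le ((add_le_add hpK.le hqL.le).trans hle)) (lt_irrefl _)

theorem mul_volume_add_mul_volume_le {A B C : Set ℝ} {t s : ℝ} (ht : 0 < t) (hs : 0 < s)
    (hA : MeasurableSet A) (hB : MeasurableSet B) (hA' : A.Nonempty) (hB' : B.Nonempty)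
    (h : ∀ x ∈ A, ∀ y ∈ B, t * x + s * y ∈ C) :
    ENNReal.ofReal t * volume A + ENNReal.ofReal s * volume B ≤ volume C := by
  have h1 := volume_add_volume_le_of_add_subset (A := t • A) (B := s • B) (C := C)
    (hA.const_smul₀ t) (hB.const_smul₀ s)
    hA'.smul_set hB'.smul_set (by
      rintro _ ⟨_, ⟨x, hx, rfl⟩, _, ⟨y, hy, rfl⟩, rfl⟩
      exact h x hx y hy)
  simpa [Measure.addHaar_smul, abs_of_pos ht, abs_of_pos hs] using h1

theorem ENNReal.geom_mean_le_arith_mean2_weighted {t s : ℝ} (ht : 0 < t) (hs : 0 < s)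
    (hts : t + s = 1) (a b : ℝ≥0∞) :
    a ^ t * b ^ s ≤ ENNReal.ofReal t * a + ENNReal.ofReal s * b := by
  induction a with
  | top => simp [ENNReal.mul_top, ht]
  | coe a =>
    induction b with
    | top => simp [ENNReal.mul_top, hs]
    | coe b =>
      lift t to ℝ≥0 using ht.le
      lift s to ℝ≥0 using hs.le
      have := NNReal.geom_mean_le_arith_mean2_weighted t s a b (by exact_mod_cast hts)
      rw [← ENNReal.coe_rpow_of_nonneg _ ht.le, ← ENNReal.coe_rpow_of_nonneg _ hs.le]
      simp only [ENNReal.ofReal_coe_nnreal]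
      exact_mod_cast this

theorem lintegral_eq_lintegral_volume_lt {u : ℝ → ℝ≥0∞} (hu : Measurable u) (hu1 : ∀ x, u x ≤ 1) :
    ∫⁻ x, u x = ∫⁻ c in Set.Ioo (0 : ℝ) 1, volume {x | ENNReal.ofReal c < u x} := by
  have hfin : ∀ x, u x ≠ ∞ := fun x => ne_top_of_le_ne_top ENNReal.one_ne_top (hu1 x)
  have h1 := lintegral_eq_lintegral_meas_lt (volume : Measure ℝ) (f := fun x => (u x).toReal)
    (by filter_upwards with x using ENNReal.toReal_nonneg) hu.ennreal_toReal.aemeasurable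
  simp only [ENNReal.ofReal_toReal (hfin _)] at h1
  rw [h1, ← lintegral_indicator measurableSet_Ioi, ← lintegral_indicator measurableSet_Ioo]
  congr 1 with c
  by_cases hc : c ∈ Set.Ioo (0 : ℝ) 1
  · rw [Set.indicator_of_mem hc, Set.indicator_of_mem (show c ∈ Set.Ioi (0 : ℝ) from hc.1)]
    congr 1 with x
    exact (ENNReal.ofReal_lt_iff_lt_toReal hc.1.le (hfin x)).symm
  · rw [Set.indicator_of_notMem hc]
    by_cases hc0 : c ∈ Set.Ioi (0 : ℝ)
    · rw [Set.indicator_of_mem hc0]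
      have : {a | c < (u a).toReal} = ∅ := by
        ext x
        simp only [Set.mem_ofPred_eq, Set.mem_empty_iff_false, iff_false, not_lt]
        have h2 : (u x).toReal ≤ 1 := ENNReal.toReal_le_of_le_ofReal zero_le_one (by simpa using hu1 x)
        have h3 : 1 ≤ c := by
          by_contra! h
          exact hc ⟨hc0, h⟩
        exact h2.trans h3
      simp [this]
    · rw [Set.indicator_of_notMem hc0]

/-- One-dimensional Prékopa–Leindler inequality for functions with supremum `1`. -/
theorem lintegral_prekopaLeindler_of_sup_eq_one {t s : ℝ} (ht : 0 < t) (hs : 0 < s)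
    (hts : t + s = 1) {u v w : ℝ → ℝ≥0∞} (hu : Measurable u) (hv : Measurable v)
    (hw : Measurable w) (hu1 : ∀ x, u x ≤ 1) (hv1 : ∀ x, v x ≤ 1)
    (hu2 : ∀ c < 1, ∃ x, c < u x) (hv2 : ∀ c < 1, ∃ x, c < v x)
    (h : ∀ x y, u x ^ t * v y ^ s ≤ w (t * x + s * y)) :
    ENNReal.ofReal t * (∫⁻ x, u x) + ENNReal.ofReal s * ∫⁻ x, v x ≤ ∫⁻ x, w x := by
  have key : ∀ c ∈ Set.Ioo (0 : ℝ) 1,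
      ENNReal.ofReal t * volume {x | ENNReal.ofReal c < u x} +
        ENNReal.ofReal s * volume {x | ENNReal.ofReal c < v x} ≤
        volume {x | ENNReal.ofReal c < min (w x) 1} := by
    intro c hc
    have hc1 : ENNReal.ofReal c < 1 := by simpa using hc.2
    refine mul_volume_add_mul_volume_le ht hs (measurableSet_lt measurable_const hu)
      (measurableSet_lt measurable_const hv) (hu2 _ hc1) (hv2 _ hc1) ?_
    intro x hx y hy
    refine lt_min (lt_of_lt_of_le ?_ (h x y)) hc1
    calc ENNReal.ofReal c = ENNReal.ofReal c ^ t * ENNReal.ofReal c ^ s := by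
          rw [← ENNReal.rpow_add_of_nonneg _ _ ht.le hs.le, hts, ENNReal.rpow_one]
      _ < u x ^ t * v y ^ s :=
          ENNReal.mul_lt_mul (ENNReal.rpow_lt_rpow hx ht) (ENNReal.rpow_lt_rpow hy hs)
  have hanti : ∀ {g : ℝ → ℝ≥0∞}, Measurable fun c : ℝ => volume {x | ENNReal.ofReal c < g x} := by
    intro g
    refine Antitone.measurable fun a b hab => measure_mono fun x hx => ?_
    exact lt_of_le_of_lt (ENNReal.ofReal_le_ofReal hab) hx
  calc ENNReal.ofReal t * (∫⁻ x, u x) + ENNReal.ofReal s * ∫⁻ x, v x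
      ≤ ∫⁻ x, min (w x) 1 := by
        rw [lintegral_eq_lintegral_volume_lt hu hu1, lintegral_eq_lintegral_volume_lt hv hv1,
          lintegral_eq_lintegral_volume_lt (hw.min measurable_const) (fun x => min_le_right _ _),
          ← lintegral_const_mul _ hanti, ← lintegral_const_mul _ hanti,
          ← lintegral_add_left (hanti.const_mul _)]
        exact setLIntegral_mono hanti key
    _ ≤ ∫⁻ x, w x := lintegral_mono fun x => min_le_left _ _

/-- Prékopa–Leindler inequality for the measure space `E`, with weights `t` and `s`. -/
def PrekopaLeindler (E : Type*) [AddCommGroup E] [Module ℝ E] [MeasureSpace E] (t s : ℝ) : Prop :=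
  ∀ u v w : E → ℝ≥0∞, Measurable u → Measurable v → Measurable w →
    (∀ x y, u x ^ t * v y ^ s ≤ w (t • x + s • y)) →
      (∫⁻ x, u x) ^ t * (∫⁻ x, v x) ^ s ≤ ∫⁻ x, w x

theorem lintegral_prekopaLeindler_of_bounded {t s : ℝ} (ht : 0 < t) (hs : 0 < s)
    (hts : t + s = 1) {u v w : ℝ → ℝ≥0∞} (hu : Measurable u) (hv : Measurable v)
    (hw : Measurable w) (hu1 : ⨆ x, u x ≠ ∞) (hv1 : ⨆ x, v x ≠ ∞)
    (h : ∀ x y, u x ^ t * v y ^ s ≤ w (t * x + s * y)) :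
    (∫⁻ x, u x) ^ t * (∫⁻ x, v x) ^ s ≤ ∫⁻ x, w x := by
  set a := ⨆ x, u x with ha
  set b := ⨆ x, v x with hb
  rcases eq_or_ne a 0 with ha0 | ha0
  · have : ∀ x, u x = 0 := by simpa [ha] using ha0
    simp [this, ht]
  rcases eq_or_ne b 0 with hb0 | hb0
  · have : ∀ x, v x = 0 := by simpa [hb] using hb0
    simp [this, hs]
  have hat : a ^ t ≠ 0 := by simp [ENNReal.rpow_eq_zero_iff, ha0, hu1]
  have hbs : b ^ s ≠ 0 := by simp [ENNReal.rpow_eq_zero_iff, hb0, hv1]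
  have hat' : a ^ t ≠ ∞ := ENNReal.rpow_ne_top_of_nonneg ht.le hu1
  have hbs' : b ^ s ≠ ∞ := ENNReal.rpow_ne_top_of_nonneg hs.le hv1
  have hk : a ^ t * b ^ s ≠ 0 := mul_ne_zero hat hbs
  have hk' : a ^ t * b ^ s ≠ ∞ := ENNReal.mul_ne_top hat' hbs'
  have hdiv : ∀ p q : ℝ≥0∞, (p / a) ^ t * (q / b) ^ s = p ^ t * q ^ s / (a ^ t * b ^ s) := by
    intro p q
    rw [ENNReal.div_rpow_of_nonneg _ _ ht.le, ENNReal.div_rpow_of_nonneg _ _ hs.le,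
      ENNReal.mul_div_mul_comm (Or.inl hat) (Or.inl hat')]
  have h1 := lintegral_prekopaLeindler_of_sup_eq_one ht hs hts (u := fun x => u x / a)
    (v := fun x => v x / b) (w := fun x => w x / (a ^ t * b ^ s))
    (hu.div_const _) (hv.div_const _) (hw.div_const _)
    (fun x => ENNReal.div_le_of_le_mul (by simpa using le_iSup u x))
    (fun x => ENNReal.div_le_of_le_mul (by simpa using le_iSup v x))
    (fun c hc => by
      have : c * a < a := by
        simpa using (ENNReal.mul_lt_mul_iff_left ha0 hu1).2 hc
      obtain ⟨x, hx⟩ := lt_iSup_iff.1 this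
      exact ⟨x, (ENNReal.lt_div_iff_mul_lt (Or.inl ha0) (Or.inl hu1)).2 hx⟩)
    (fun c hc => by
      have : c * b < b := by
        simpa using (ENNReal.mul_lt_mul_iff_left hb0 hv1).2 hc
      obtain ⟨x, hx⟩ := lt_iSup_iff.1 this
      exact ⟨x, (ENNReal.lt_div_iff_mul_lt (Or.inl hb0) (Or.inl hv1)).2 hx⟩)
    (fun x y => by
      rw [hdiv]
      exact ENNReal.div_le_div_right (h x y) _)
  have h2 := (ENNReal.geom_mean_le_arith_mean2_weighted ht hs hts _ _).trans h1
  simp only [div_eq_mul_inv] at h2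
  rw [lintegral_mul_const _ hu, lintegral_mul_const _ hv, lintegral_mul_const _ hw] at h2
  simp only [← div_eq_mul_inv] at h2
  rw [hdiv] at h2
  simpa only [ENNReal.div_mul_cancel hk hk'] using mul_le_mul_left h2 (a ^ t * b ^ s)

theorem prekopaLeindler_real {t s : ℝ} (ht : 0 < t) (hs : 0 < s) (hts : t + s = 1) :
    PrekopaLeindler ℝ t s := by
  intro u v w hu hv hw h
  have hsup : ∀ {g : ℝ → ℝ≥0∞}, Measurable g →
      ∫⁻ x, g x = ⨆ n : ℕ, ∫⁻ x, min (g x) n := by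
    intro g hg
    rw [← lintegral_iSup (fun n => hg.min measurable_const)
      (fun m n hmn x => min_le_min_left _ (by exact_mod_cast hmn))]
    congr 1 with x
    rw [← inf_iSup_eq, ENNReal.iSup_natCast, inf_top_eq]
  have hmono : ∀ {g : ℝ → ℝ≥0∞}, Monotone fun n : ℕ => ∫⁻ x, min (g x) n := by
    intro g m n hmn
    exact lintegral_mono fun x => min_le_min_left _ (by exact_mod_cast hmn)
  have hb : ∀ (g : ℝ → ℝ≥0∞) (n : ℕ), ⨆ x, min (g x) n ≠ ∞ := fun g n =>
    ne_top_of_le_ne_top (ENNReal.natCast_ne_top n) (iSup_le fun x => min_le_right _ _)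
  have key : ∀ n : ℕ, (∫⁻ x, min (u x) n) ^ t * (∫⁻ x, min (v x) n) ^ s ≤ ∫⁻ x, w x := fun n =>
    lintegral_prekopaLeindler_of_bounded ht hs hts (hu.min measurable_const)
      (hv.min measurable_const) hw (hb u n) (hb v n) fun x y =>
      (mul_le_mul' (ENNReal.rpow_le_rpow (min_le_left _ _) ht.le)
        (ENNReal.rpow_le_rpow (min_le_left _ _) hs.le)).trans (h x y)
  have hpow : ∀ {r : ℝ}, 0 < r → ∀ F : ℕ → ℝ≥0∞, (⨆ n, F n) ^ r = ⨆ n, F n ^ r := fun hr F =>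
    (ENNReal.orderIsoRpow _ hr).map_iSup F
  rw [hsup hu, hsup hv, hpow ht, hpow hs, ENNReal.iSup_mul]
  refine iSup_le fun m => ?_
  rw [ENNReal.mul_iSup]
  refine iSup_le fun n => ?_
  exact (mul_le_mul' (ENNReal.rpow_le_rpow (hmono (le_max_left m n)) ht.le)
    (ENNReal.rpow_le_rpow (hmono (le_max_right m n)) hs.le)).trans (key (max m n))

theorem PrekopaLeindler.prod {E F : Type*} [AddCommGroup E] [Module ℝ E] [MeasureSpace E]
    [AddCommGroup F] [Module ℝ F] [MeasureSpace F] [SFinite (volume : Measure F)] {t s : ℝ}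
    (hE : PrekopaLeindler E t s) (hF : PrekopaLeindler F t s) : PrekopaLeindler (E × F) t s := by
  intro u v w hu hv hw h
  simp only [Measure.volume_eq_prod]
  rw [lintegral_prod _ hu.aemeasurable, lintegral_prod _ hv.aemeasurable,
    lintegral_prod _ hw.aemeasurable]
  refine hE _ _ _ hu.lintegral_prod_right' hv.lintegral_prod_right' hw.lintegral_prod_right' ?_
  intro x y
  exact hF _ _ _ (by fun_prop) (by fun_prop) (by fun_prop) fun x' y' => h (x, x') (y, y')

theorem PrekopaLeindler.of_measurePreserving {E F : Type*} [AddCommGroup E] [Module ℝ E]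
    [MeasureSpace E] [AddCommGroup F] [Module ℝ F] [MeasureSpace F] {t s : ℝ}
    (hE : PrekopaLeindler E t s) (e : E → F) (he : MeasurePreserving e)
    (hlin : ∀ x y, e (t • x + s • y) = t • e x + s • e y) : PrekopaLeindler F t s := by
  intro u v w hu hv hw h
  rw [← he.lintegral_comp hu, ← he.lintegral_comp hv, ← he.lintegral_comp hw]
  refine hE _ _ _ (hu.comp he.measurable) (hv.comp he.measurable) (hw.comp he.measurable) ?_
  intro x y
  rw [hlin]
  exact h _ _

theorem prekopaLeindler_pi {t s : ℝ} (ht : 0 < t) (hs : 0 < s) (hts : t + s = 1) (n : ℕ) :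
    PrekopaLeindler (Fin n → ℝ) t s := by
  induction n with
  | zero =>
    intro u v w hu hv hw h
    have h0 := h (@default _ Unique.instInhabited) (@default _ Unique.instInhabited)
    have hv : (volume : Measure (Fin 0 → ℝ)) Set.univ = 1 := by
      simp [volume_pi]
    rw [Subsingleton.elim (t • (@default (Fin 0 → ℝ) Unique.instInhabited) +
      s • (@default (Fin 0 → ℝ) Unique.instInhabited)) (@default (Fin 0 → ℝ) Unique.instInhabited)] at h0
    simpa only [lintegral_unique, hv, mul_one] using h0
  | succ n ih =>
    refine ((prekopaLeindler_real ht hs hts).prod ih).of_measurePreserving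
      (MeasurableEquiv.piFinSuccAbove (fun _ => ℝ) 0).symm
      (volume_preserving_piFinSuccAbove (fun _ => ℝ) 0).symm ?_
    intro x y
    ext i
    refine Fin.cases ?_ (fun j => ?_) i <;> simp [MeasurableEquiv.piFinSuccAbove]

theorem prekopaLeindler_euclideanSpace {t s : ℝ} (ht : 0 < t) (hs : 0 < s) (hts : t + s = 1)
    (n : ℕ) : PrekopaLeindler (EuclideanSpace ℝ (Fin n)) t s :=
  (prekopaLeindler_pi ht hs hts n).of_measurePreserving (WithLp.toLp 2)
    (PiLp.volume_preserving_toLp _) fun x y => by simp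

theorem strongConvexOn_of_le_fderiv_fderiv {E : Type*} [NormedAddCommGroup E] [NormedSpace ℝ E]
    {R : ℝ} {U : E → ℝ} (hU : ContDiff ℝ 2 U)
    (hHess : ∀ x v : E, R * ‖v‖ ^ 2 ≤ fderiv ℝ (fderiv ℝ U) x v v) :
    StrongConvexOn Set.univ R U := by
  refine ⟨convex_univ, fun x _ y _ t s ht hs hts => ?_⟩
  set d := x - y with hd
  have hU1 : Differentiable ℝ U := hU.differentiable (by norm_num)
  have hU2 : Differentiable ℝ (fderiv ℝ U) :=
    (hU.fderiv_right (m := 1) (by norm_num)).differentiable (by norm_num)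
  have hline : ∀ r : ℝ, HasDerivAt (fun r : ℝ => y + r • d) d r := fun r => by
    simpa using ((hasDerivAt_id r).smul_const d).const_add y
  have h1 : ∀ r : ℝ, HasDerivAt (fun r : ℝ => U (y + r • d) - R * ‖d‖ ^ 2 / 2 * r ^ 2)
      (fderiv ℝ U (y + r • d) d - R * ‖d‖ ^ 2 * r) r := fun r => by
    have := ((hU1 (y + r • d)).hasFDerivAt.comp_hasDerivAt r (hline r)).sub
      ((hasDerivAt_pow 2 r).const_mul (R * ‖d‖ ^ 2 / 2))
    refine this.congr_deriv ?_
    norm_num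
    ring
  have h2 : ∀ r : ℝ, HasDerivAt (fun r : ℝ => fderiv ℝ U (y + r • d) d - R * ‖d‖ ^ 2 * r)
      (fderiv ℝ (fderiv ℝ U) (y + r • d) d d - R * ‖d‖ ^ 2) r := fun r => by
    have hD : HasDerivAt (fun r : ℝ => fderiv ℝ U (y + r • d))
        (fderiv ℝ (fderiv ℝ U) (y + r • d) d) r :=
      (hU2 (y + r • d)).hasFDerivAt.comp_hasDerivAt r (hline r)
    have hD' : HasDerivAt (fun r : ℝ => fderiv ℝ U (y + r • d) d)
        (fderiv ℝ (fderiv ℝ U) (y + r • d) d d) r := by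
      simpa using hD.clm_apply (hasDerivAt_const r d)
    refine (hD'.sub ((hasDerivAt_id r).const_mul (R * ‖d‖ ^ 2))).congr_deriv ?_
    simp
  have hd1 := funext fun r => (h1 r).deriv
  have hconv : ConvexOn ℝ Set.univ (fun r : ℝ => U (y + r • d) - R * ‖d‖ ^ 2 / 2 * r ^ 2) := by
    refine convexOn_univ_of_deriv2_nonneg (fun r => (h1 r).differentiableAt) ?_ ?_
    · rw [hd1]
      exact fun r => (h2 r).differentiableAt
    · intro r
      rw [Function.iterate_succ, Function.iterate_one, Function.comp_apply, hd1, (h2 r).deriv]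
      linarith [hHess (y + r • d) d]
  have h3 := hconv.2 (Set.mem_univ 1) (Set.mem_univ 0) ht hs hts
  have hx : y + (1 : ℝ) • d = x := by simp [hd]
  have hz : y + t • d = t • x + s • y := by
    rw [hd, eq_sub_iff_add_eq'.2 hts]
    module
  simp only [smul_eq_mul, mul_one, mul_zero, add_zero, hx, hz, zero_smul] at h3
  have hs' : s = 1 - t := by linarith
  simp only [smul_eq_mul]
  subst hs'
  nlinarith [h3]

/-- Quadratic upper bound for `log (f ^ 2 + ε)` in terms of its gradient. -/
theorem log_sq_add_le {E : Type*} [NormedAddCommGroup E] [NormedSpace ℝ E] {f : E → ℝ}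
    (hf : ContDiff ℝ 2 f) {A L M : ℝ} (hA : ∀ x, |f x| ≤ A) (hL : ∀ x, ‖fderiv ℝ f x‖ ≤ L)
    (hM : ∀ x, ‖fderiv ℝ (fderiv ℝ f) x‖ ≤ M) {ε : ℝ} (hε : 0 < ε) (x z : E) :
    Real.log (f x ^ 2 + ε) ≤ Real.log (f z ^ 2 + ε) +
      2 * |f z| * ‖fderiv ℝ f z‖ / (f z ^ 2 + ε) * ‖x - z‖ +
      (2 * A * M + L ^ 2) / ε * ‖x - z‖ ^ 2 := by
  have hf1 : Differentiable ℝ f := hf.differentiable (by norm_num)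
  have hf2 : Differentiable ℝ (fderiv ℝ f) :=
    (hf.fderiv_right (m := 1) (by norm_num)).differentiable (by norm_num)
  have hA0 : 0 ≤ A := (abs_nonneg _).trans (hA x)
  have hM0 : 0 ≤ M := (norm_nonneg (fderiv ℝ (fderiv ℝ f) x)).trans (hM x)
  have h1 : |f x - f z| ≤ L * ‖x - z‖ :=
    convex_univ.norm_image_sub_le_of_norm_fderiv_le (fun y _ => hf1 y) (fun y _ => hL y)
      (Set.mem_univ z) (Set.mem_univ x)
  have h2 : |f x - f z - fderiv ℝ f z (x - z)| ≤ M * ‖x - z‖ * ‖x - z‖ := by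
    refine (convex_segment z x).norm_image_sub_le_of_norm_fderiv_le' (fun y _ => hf1 y)
      (fun y hy => ?_) (left_mem_segment ℝ z x) (right_mem_segment ℝ z x)
    refine (convex_univ.norm_image_sub_le_of_norm_fderiv_le (fun y _ => hf2 y) (fun y _ => hM y)
      (Set.mem_univ z) (Set.mem_univ y)).trans ?_
    gcongr
    exact norm_sub_le_of_mem_segment hy
  have h3 : |fderiv ℝ f z (x - z)| ≤ ‖fderiv ℝ f z‖ * ‖x - z‖ := (fderiv ℝ f z).le_opNorm _
  have hpz : 0 < f z ^ 2 + ε := by positivity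
  have hpx : 0 < f x ^ 2 + ε := by positivity
  have hlog : Real.log (f x ^ 2 + ε) - Real.log (f z ^ 2 + ε) ≤
      (f x ^ 2 - f z ^ 2) / (f z ^ 2 + ε) := by
    rw [← Real.log_div hpx.ne' hpz.ne']
    refine (Real.log_le_sub_one_of_pos (by positivity)).trans_eq ?_
    field_simp
    ring
  have hsq : f x ^ 2 - f z ^ 2 ≤ 2 * |f z| * ‖fderiv ℝ f z‖ * ‖x - z‖ +
      (2 * A * M + L ^ 2) * ‖x - z‖ ^ 2 := by
    have e : f x ^ 2 - f z ^ 2 = 2 * (f z * fderiv ℝ f z (x - z)) +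
        2 * (f z * (f x - f z - fderiv ℝ f z (x - z))) + (f x - f z) ^ 2 := by ring
    have e1 : f z * fderiv ℝ f z (x - z) ≤ |f z| * (‖fderiv ℝ f z‖ * ‖x - z‖) :=
      (le_abs_self _).trans (by rw [abs_mul]; gcongr)
    have e2 : f z * (f x - f z - fderiv ℝ f z (x - z)) ≤ A * (M * ‖x - z‖ * ‖x - z‖) :=
      (le_abs_self _).trans (by rw [abs_mul]; gcongr; exact hA z)
    have e3 : (f x - f z) ^ 2 ≤ (L * ‖x - z‖) ^ 2 := sq_le_sq' (by linarith [neg_abs_le (f x - f z)])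
      ((le_abs_self _).trans h1)
    rw [e]
    linarith
  have hK : (2 * A * M + L ^ 2) * ‖x - z‖ ^ 2 / (f z ^ 2 + ε) ≤
      (2 * A * M + L ^ 2) / ε * ‖x - z‖ ^ 2 := by
    rw [div_mul_eq_mul_div]
    gcongr
    nlinarith [sq_nonneg (f z)]
  have hdiv : (f x ^ 2 - f z ^ 2) / (f z ^ 2 + ε) ≤
      2 * |f z| * ‖fderiv ℝ f z‖ / (f z ^ 2 + ε) * ‖x - z‖ +
        (2 * A * M + L ^ 2) * ‖x - z‖ ^ 2 / (f z ^ 2 + ε) := by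
    rw [div_mul_eq_mul_div, ← add_div]
    gcongr
  linarith

theorem hasDerivAt_integral_exp_add_mul {α : Type*} [TopologicalSpace α] [MeasurableSpace α]
    [BorelSpace α] {μ : Measure α} [IsProbabilityMeasure μ] {g h : α → ℝ}
    (hg : Continuous g) (hh : Continuous h) {A B : ℝ} (hA : ∀ x, |g x| ≤ A)
    (hB : ∀ x, |h x| ≤ B) :
    HasDerivAt (fun ε : ℝ => ∫ x, Real.exp (g x + ε * h x) ∂μ) (∫ x, h x * Real.exp (g x) ∂μ) 0 := by
  have hmeas : ∀ {k : α → ℝ}, Continuous k → AEStronglyMeasurable k μ := fun hk =>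
    hk.measurable.aestronglyMeasurable
  have hd := hasDerivAt_integral_of_dominated_loc_of_deriv_le (μ := μ) (x₀ := (0 : ℝ))
    (F := fun ε x => Real.exp (g x + ε * h x)) (F' := fun ε x => h x * Real.exp (g x + ε * h x))
    (bound := fun _ => B * Real.exp (A + B)) (Metric.ball_mem_nhds 0 one_pos)
    (Filter.Eventually.of_forall fun ε => hmeas (by fun_prop))
    (Integrable.of_bound (hmeas (by fun_prop)) (Real.exp A) (Filter.Eventually.of_forall fun x => by
      simpa using (le_abs_self _).trans (hA x)))
    (hmeas (by fun_prop))
    (Filter.Eventually.of_forall fun x ε hε => by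
      have hB0 : 0 ≤ B := (abs_nonneg _).trans (hB x)
      have hε' : |ε| ≤ 1 := by simpa using (Metric.mem_ball.1 hε).le
      rw [norm_mul, Real.norm_eq_abs, Real.norm_eq_abs, Real.abs_exp]
      gcongr
      · exact hB x
      · exact (le_abs_self _).trans (hA x)
      · calc ε * h x ≤ |ε * h x| := le_abs_self _
          _ = |ε| * |h x| := abs_mul _ _
          _ ≤ 1 * B := by gcongr; exact hB x
          _ = B := one_mul B)
    (integrable_const _)
    (Filter.Eventually.of_forall fun x ε _ => by
      have := (((hasDerivAt_id ε).mul_const (h x)).const_add (g x)).exp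
      refine this.congr_deriv ?_
      simp [mul_comm])
  simpa using hd.2

theorem deriv_nonneg_of_nonneg_right {F : ℝ → ℝ} {F' δ : ℝ} (hF : HasDerivAt F F' 0)
    (hF0 : F 0 = 0) (hδ : 0 < δ) (hpos : ∀ ε, 0 < ε → ε ≤ δ → 0 ≤ F ε) : 0 ≤ F' := by
  have h := (hasDerivWithinAt_iff_tendsto_slope' (s := Set.Ioi (0 : ℝ)) (by simp)).1
    hF.hasDerivWithinAt
  refine ge_of_tendsto h ?_
  filter_upwards [Ioc_mem_nhdsGT hδ] with ε hε
  rw [slope_def_field, hF0]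
  exact div_nonneg (by simpa using hpos ε hε.1 hε.2) (by simpa using hε.1.le)

theorem integral_exp_one_add_mul_le {n : ℕ} {R R' K B ε : ℝ} (hR' : 0 < R') (hε : 0 < ε)
    (hεK : 2 * ε * K ≤ R - R') {U : EuclideanSpace ℝ (Fin n) → ℝ} (hU : Continuous U)
    (hconv : StrongConvexOn Set.univ R U) {μ : Measure (EuclideanSpace ℝ (Fin n))}
    (hμ : μ = volume.withDensity (fun x => ENNReal.ofReal (Real.exp (-U x))))
    [IsProbabilityMeasure μ] {g D : EuclideanSpace ℝ (Fin n) → ℝ} (hg : Continuous g)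
    (hD : Continuous D) (hgB : ∀ x, |g x| ≤ B) (hDB : ∀ x, |D x ^ 2 / (2 * R')| ≤ B)
    (hquad : ∀ x z, g x ≤ g z + D z * ‖x - z‖ + K * ‖x - z‖ ^ 2) :
    ∫ x, Real.exp (g x + ε * g x) ∂μ ≤
      (∫ x, Real.exp (g x + ε * (D x ^ 2 / (2 * R'))) ∂μ) ^ (1 + ε) := by
  have hε1 : 0 < 1 + ε := by linarith
  set t : ℝ := (1 + ε)⁻¹ with ht
  set s : ℝ := ε * (1 + ε)⁻¹ with hs
  have ht0 : 0 < t := by positivity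
  have hs0 : 0 < s := by positivity
  have hts : t + s = 1 := by rw [ht, hs]; field_simp
  have hst : s = ε * t := rfl
  have hte : (1 + ε) * t = 1 := mul_inv_cancel₀ hε1.ne'
  have hpoint : ∀ x y, t * (g x + ε * g x - U x) + s * (-U y) ≤
      g (t • x + s • y) + ε * (D (t • x + s • y) ^ 2 / (2 * R')) - U (t • x + s • y) := by
    intro x y
    have h1 := hconv.2 (Set.mem_univ x) (Set.mem_univ y) ht0.le hs0.le hts
    simp only [smul_eq_mul] at h1
    set z := t • x + s • y with hz
    have h2 := hquad x z
    have hxz : x - z = s • (x - y) := by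
      rw [hz, eq_sub_iff_add_eq.2 hts]
      module
    have hn : ‖x - z‖ = s * ‖x - y‖ := by
      rw [hxz, norm_smul, Real.norm_of_nonneg hs0.le]
    have h3 : t * s * (R / 2 * ‖x - y‖ ^ 2) = R / (2 * ε) * ‖x - z‖ ^ 2 := by
      rw [hn, hst]
      field_simp
    have h4 : t * (g x + ε * g x) = g x := by linear_combination g x * hte
    have h5 : D z * ‖x - z‖ ≤ ε * (D z ^ 2 / (2 * R')) + R' / (2 * ε) * ‖x - z‖ ^ 2 := by
      have : ε * (D z ^ 2 / (2 * R')) + R' / (2 * ε) * ‖x - z‖ ^ 2 - D z * ‖x - z‖ =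
          (ε * D z - R' * ‖x - z‖) ^ 2 / (2 * R' * ε) := by
        field_simp
        ring
      have : 0 ≤ (ε * D z - R' * ‖x - z‖) ^ 2 / (2 * R' * ε) := by positivity
      linarith
    have h6 : (R' / (2 * ε) + K) * ‖x - z‖ ^ 2 ≤ R / (2 * ε) * ‖x - z‖ ^ 2 := by
      gcongr
      rw [← sub_nonneg]
      have : R / (2 * ε) - (R' / (2 * ε) + K) = (R - R' - 2 * ε * K) / (2 * ε) := by
        field_simp
        ring
      rw [this]
      exact div_nonneg (by linarith) (by positivity)
    linarith
  have hdens : Measurable fun x => ENNReal.ofReal (Real.exp (-U x)) := by fun_prop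
  have hlint : ∀ {k : EuclideanSpace ℝ (Fin n) → ℝ}, Continuous k →
      ∫⁻ x, ENNReal.ofReal (Real.exp (k x - U x)) = ∫⁻ x, ENNReal.ofReal (Real.exp (k x)) ∂μ := by
    intro k hk
    rw [hμ, lintegral_withDensity_eq_lintegral_mul _ hdens (by fun_prop)]
    refine lintegral_congr fun x => ?_
    rw [Pi.mul_apply, ← ENNReal.ofReal_mul (Real.exp_pos _).le, ← Real.exp_add]
    ring_nf
  have hint : ∀ {k : EuclideanSpace ℝ (Fin n) → ℝ}, Continuous k → (∀ x, |k x| ≤ B) →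
      ENNReal.ofReal (∫ x, Real.exp (g x + ε * k x) ∂μ) =
        ∫⁻ x, ENNReal.ofReal (Real.exp (g x + ε * k x)) ∂μ := by
    intro k hk hkB
    refine ofReal_integral_eq_lintegral_ofReal ?_ (Filter.Eventually.of_forall fun x =>
      (Real.exp_pos _).le)
    refine Integrable.of_bound (by fun_prop) (Real.exp (B + ε * B))
      (Filter.Eventually.of_forall fun x => ?_)
    rw [Real.norm_eq_abs, Real.abs_exp]
    gcongr
    · exact (le_abs_self _).trans (hgB x)
    · exact (le_abs_self _).trans (hkB x)
  have hPL := prekopaLeindler_euclideanSpace ht0 hs0 hts n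
    (fun x => ENNReal.ofReal (Real.exp (g x + ε * g x - U x)))
    (fun x => ENNReal.ofReal (Real.exp (-U x)))
    (fun x => ENNReal.ofReal (Real.exp (g x + ε * (D x ^ 2 / (2 * R')) - U x)))
    (by fun_prop) (by fun_prop) (by fun_prop) (fun x y => by
      rw [ENNReal.ofReal_rpow_of_pos (Real.exp_pos _), ENNReal.ofReal_rpow_of_pos (Real.exp_pos _),
        ← ENNReal.ofReal_mul (by positivity), ← Real.exp_mul, ← Real.exp_mul, ← Real.exp_add]
      refine ENNReal.ofReal_le_ofReal (Real.exp_le_exp.2 ?_)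
      linarith [hpoint x y])
  have hone : ∫⁻ x, ENNReal.ofReal (Real.exp (-U x)) = 1 := by
    rw [← setLIntegral_univ, ← withDensity_apply _ MeasurableSet.univ, ← hμ, measure_univ]
  rw [hone, hlint (by fun_prop), hlint (by fun_prop), ← hint hg hgB,
    ← hint (k := fun x => D x ^ 2 / (2 * R')) (by fun_prop) hDB, ENNReal.one_rpow, mul_one] at hPL
  have hpos : ∀ k : EuclideanSpace ℝ (Fin n) → ℝ, 0 ≤ ∫ x, Real.exp (k x) ∂μ := fun k =>
    integral_nonneg fun x => (Real.exp_pos _).le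
  rw [ENNReal.ofReal_rpow_of_nonneg (hpos _) ht0.le, ENNReal.ofReal_le_ofReal_iff (hpos _)] at hPL
  calc ∫ x, Real.exp (g x + ε * g x) ∂μ
      = ((∫ x, Real.exp (g x + ε * g x) ∂μ) ^ t) ^ (1 + ε) := by
        rw [← Real.rpow_mul (hpos _), mul_comm, hte, Real.rpow_one]
    _ ≤ _ := Real.rpow_le_rpow (Real.rpow_nonneg (hpos _) _) hPL hε1.le

/-- Logarithmic Sobolev inequality for `exp g`, where `D` plays the role of the norm of the
gradient of the semiconcave function `g`. -/
theorem integral_mul_exp_sub_le {n : ℕ} {R K B : ℝ} (hR : 0 < R)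
    {U : EuclideanSpace ℝ (Fin n) → ℝ} (hU : Continuous U)
    (hconv : StrongConvexOn Set.univ R U) {μ : Measure (EuclideanSpace ℝ (Fin n))}
    (hμ : μ = volume.withDensity (fun x => ENNReal.ofReal (Real.exp (-U x))))
    [IsProbabilityMeasure μ] {g D : EuclideanSpace ℝ (Fin n) → ℝ} (hg : Continuous g)
    (hD : Continuous D) (hgB : ∀ x, |g x| ≤ B) (hDB : ∀ x, |D x| ≤ B)
    (hquad : ∀ x z, g x ≤ g z + D z * ‖x - z‖ + K * ‖x - z‖ ^ 2) :
    ∫ x, g x * Real.exp (g x) ∂μ -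
        (∫ x, Real.exp (g x) ∂μ) * Real.log (∫ x, Real.exp (g x) ∂μ) ≤
      1 / (2 * R) * ∫ x, D x ^ 2 * Real.exp (g x) ∂μ := by
  set N : ℝ := ∫ x, Real.exp (g x) ∂μ with hN
  have key : ∀ R', 0 < R' → R' < R → ∫ x, g x * Real.exp (g x) ∂μ - N * Real.log N ≤
      1 / (2 * R') * ∫ x, D x ^ 2 * Real.exp (g x) ∂μ := by
    intro R' hR' hlt
    set B' : ℝ := max B (B ^ 2 / (2 * R')) with hB'
    have hgB' : ∀ x, |g x| ≤ B' := fun x => (hgB x).trans (le_max_left _ _)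
    have hDB' : ∀ x, |D x ^ 2 / (2 * R')| ≤ B' := fun x => by
      refine le_trans ?_ (le_max_right _ _)
      rw [abs_of_nonneg (by positivity), ← sq_abs (D x)]
      gcongr
      exact hDB x
    have hd1 := hasDerivAt_integral_exp_add_mul (μ := μ) hg hg hgB' hgB'
    have hd2 := hasDerivAt_integral_exp_add_mul (μ := μ) (h := fun x => D x ^ 2 / (2 * R')) hg
      (by fun_prop) hgB' hDB'
    have hN0 : 0 < N := integral_exp_pos (Integrable.of_bound
      (hg.rexp.measurable.aestronglyMeasurable) (Real.exp B) (Filter.Eventually.of_forall fun x => by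
        simpa using (le_abs_self _).trans (hgB x)))
    have hd3 := (hd2.rpow ((hasDerivAt_id (0 : ℝ)).const_add 1) (by simpa [← hN] using hN0)).sub hd1
    have hK : ∃ δ > 0, ∀ ε, 0 < ε → ε ≤ δ → 2 * ε * K ≤ R - R' := by
      refine ⟨(R - R') / (2 * (|K| + 1)), div_pos (by linarith) (by positivity), ?_⟩
      intro ε hε hε'
      rw [le_div_iff₀ (by positivity)] at hε'
      nlinarith [le_abs_self K]
    obtain ⟨δ, hδ, hδK⟩ := hK
    have hnn := deriv_nonneg_of_nonneg_right hd3 (by simp) hδ (fun ε hε hεδ =>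
      sub_nonneg.2 (integral_exp_one_add_mul_le hR' hε (hδK ε hε hεδ) hU hconv hμ hg hD hgB' hDB'
        hquad))
    have hpull : ∫ x, D x ^ 2 / (2 * R') * Real.exp (g x) ∂μ =
        1 / (2 * R') * ∫ x, D x ^ 2 * Real.exp (g x) ∂μ := by
      rw [← integral_const_mul]
      congr 1 with x
      ring
    simp only [zero_mul, add_zero, ← hN, id, sub_self, Real.rpow_zero, Real.rpow_one, mul_one,
      one_mul, hpull] at hnn
    linarith
  have htend : Filter.Tendsto (fun R' : ℝ => 1 / (2 * R') * ∫ x, D x ^ 2 * Real.exp (g x) ∂μ)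
      (nhdsWithin R (Set.Iio R)) (nhds (1 / (2 * R) * ∫ x, D x ^ 2 * Real.exp (g x) ∂μ)) := by
    refine Filter.Tendsto.mono_left ?_ nhdsWithin_le_nhds
    have : ContinuousAt (fun R' : ℝ => 1 / (2 * R')) R := by
      refine ContinuousAt.div continuousAt_const (by fun_prop) (by positivity)
    exact this.tendsto.mul_const _
  refine ge_of_tendsto htend ?_
  filter_upwards [Ioo_mem_nhdsLT hR] with R' h using key R' h.1 h.2

theorem integral_log_sobolev_sq_add_le {n : ℕ} {R : ℝ} (hR : 0 < R)
    {U : EuclideanSpace ℝ (Fin n) → ℝ} (hU : Continuous U)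
    (hconv : StrongConvexOn Set.univ R U) {μ : Measure (EuclideanSpace ℝ (Fin n))}
    (hμ : μ = volume.withDensity (fun x => ENNReal.ofReal (Real.exp (-U x))))
    [IsProbabilityMeasure μ] {f : EuclideanSpace ℝ (Fin n) → ℝ} (hf : ContDiff ℝ 2 f)
    {A L M : ℝ} (hA : ∀ x, |f x| ≤ A) (hL : ∀ x, ‖fderiv ℝ f x‖ ≤ L)
    (hM : ∀ x, ‖fderiv ℝ (fderiv ℝ f) x‖ ≤ M) {ε : ℝ} (hε : 0 < ε) :
    ∫ x, (f x ^ 2 + ε) * Real.log (f x ^ 2 + ε) ∂μ -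
        (∫ x, (f x ^ 2 + ε) ∂μ) * Real.log (∫ x, (f x ^ 2 + ε) ∂μ) ≤
      2 / R * ∫ x, ‖fderiv ℝ f x‖ ^ 2 ∂μ := by
  have hpos : ∀ x, 0 < f x ^ 2 + ε := fun x => by positivity
  have hA0 : 0 ≤ A := (abs_nonneg (f 0)).trans (hA 0)
  have hL0 : 0 ≤ L := (norm_nonneg (fderiv ℝ f 0)).trans (hL 0)
  have hfc : Continuous f := hf.continuous
  have hfdc : Continuous (fderiv ℝ f) := hf.continuous_fderiv (by norm_num)
  have hgB : ∀ x, |Real.log (f x ^ 2 + ε)| ≤ |Real.log ε| + |Real.log (A ^ 2 + ε)| := fun x => by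
    have h1 : Real.log ε ≤ Real.log (f x ^ 2 + ε) :=
      Real.log_le_log hε (by linarith [sq_nonneg (f x)])
    have h2 : Real.log (f x ^ 2 + ε) ≤ Real.log (A ^ 2 + ε) := by
      refine Real.log_le_log (hpos x) ?_
      rw [← sq_abs (f x)]
      gcongr
      exact hA x
    rw [abs_le]
    constructor
    · linarith [neg_abs_le (Real.log ε), abs_nonneg (Real.log (A ^ 2 + ε))]
    · linarith [le_abs_self (Real.log (A ^ 2 + ε)), abs_nonneg (Real.log ε)]
  have hDB : ∀ x, |2 * |f x| * ‖fderiv ℝ f x‖ / (f x ^ 2 + ε)| ≤ 2 * A * L / ε := fun x => by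
    rw [abs_of_nonneg (by positivity)]
    gcongr
    · exact hA x
    · exact hL x
    · linarith [sq_nonneg (f x)]
  have h := integral_mul_exp_sub_le hR hU hconv hμ
    (hg := (by fun_prop (disch := exact fun x => (hpos x).ne') :
      Continuous fun x => Real.log (f x ^ 2 + ε)))
    (hD := (by fun_prop (disch := exact fun x => (hpos x).ne') :
      Continuous fun x => 2 * |f x| * ‖fderiv ℝ f x‖ / (f x ^ 2 + ε)))
    (fun x => (hgB x).trans (le_max_left _ (2 * A * L / ε)))
    (fun x => (hDB x).trans (le_max_right _ _)) (log_sq_add_le hf hA hL hM hε)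
  simp only [Real.exp_log (hpos _)] at h
  have hle : ∫ x, (2 * |f x| * ‖fderiv ℝ f x‖ / (f x ^ 2 + ε)) ^ 2 * (f x ^ 2 + ε) ∂μ ≤
      ∫ x, 4 * ‖fderiv ℝ f x‖ ^ 2 ∂μ := by
    refine integral_mono_of_nonneg (Filter.Eventually.of_forall fun x =>
      mul_nonneg (sq_nonneg _) (hpos x).le) ?_ (Filter.Eventually.of_forall fun x => ?_)
    · refine Integrable.of_bound (by fun_prop) (4 * L ^ 2) (Filter.Eventually.of_forall fun x => ?_)
      rw [Real.norm_of_nonneg (by positivity)]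
      gcongr
      exact hL x
    · have e : (2 * |f x| * ‖fderiv ℝ f x‖ / (f x ^ 2 + ε)) ^ 2 * (f x ^ 2 + ε) =
          f x ^ 2 * (4 * ‖fderiv ℝ f x‖ ^ 2) / (f x ^ 2 + ε) := by
        have := (hpos x).ne'
        rw [div_pow, mul_pow, mul_pow, sq_abs]
        field_simp
        ring
      simp only [e]
      rw [div_le_iff₀ (hpos x), mul_comm]
      gcongr
      linarith
  rw [integral_const_mul] at hle
  calc _ ≤ _ := by simpa only [mul_comm (Real.log _)] using h
    _ ≤ 1 / (2 * R) * (4 * ∫ x, ‖fderiv ℝ f x‖ ^ 2 ∂μ) := by gcongr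
    _ = 2 / R * ∫ x, ‖fderiv ℝ f x‖ ^ 2 ∂μ := by
      field_simp
      ring

theorem tendsto_integral_comp_add {α : Type*} [TopologicalSpace α] [MeasurableSpace α]
    [BorelSpace α] {μ : Measure α} [IsFiniteMeasure μ] {φ : ℝ → ℝ} (hφ : Continuous φ)
    {k : α → ℝ} (hk : Continuous k) {A : ℝ} (hA : ∀ x, |k x| ≤ A) :
    Filter.Tendsto (fun ε : ℝ => ∫ x, φ (k x + ε) ∂μ) (nhdsWithin 0 (Set.Ioi 0))
      (nhds (∫ x, φ (k x) ∂μ)) := by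
  obtain ⟨C, hC⟩ := (isCompact_Icc (a := -(A + 1)) (b := A + 1)).exists_bound_of_continuousOn
    hφ.continuousOn
  refine tendsto_integral_filter_of_dominated_convergence (fun _ => C)
    (Filter.Eventually.of_forall fun ε =>
      (hφ.comp (hk.add continuous_const)).measurable.aestronglyMeasurable) ?_
    (integrable_const _) (Filter.Eventually.of_forall fun x => ?_)
  · filter_upwards [Ioo_mem_nhdsGT one_pos] with ε hε
    refine Filter.Eventually.of_forall fun x => hC _ ?_
    have := abs_le.1 (hA x)
    constructor <;> linarith [hε.1, hε.2]
  · have h : Filter.Tendsto (fun ε : ℝ => φ (k x + ε)) (nhds 0) (nhds (φ (k x + 0))) :=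
      (by fun_prop : Continuous fun ε : ℝ => φ (k x + ε)).tendsto 0
    rw [add_zero] at h
    exact h.mono_left nhdsWithin_le_nhds

end

/-- log-Sobolev inequality of Bakry–Emery for uniformly log-concave
measures: `∫ f² ln f² dμ − (∫ f² dμ) ln (∫ f² dμ) ≤ (2/R) ∫ ‖∇f‖² dμ`.
(Here `Real.log 0 = 0`, which implements the convention `0·ln 0 = 0`.) -/
theorem stmt_5 (n : ℕ) (R : ℝ) (hR : 0 < R)
    (U : EuclideanSpace ℝ (Fin n) → ℝ) (hU : ContDiff ℝ (⊤ : ℕ∞) U)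
    (hHess : ∀ x v : EuclideanSpace ℝ (Fin n), R * ‖v‖ ^ 2 ≤ fderiv ℝ (fderiv ℝ U) x v v)
    (μ : Measure (EuclideanSpace ℝ (Fin n)))
    (hμ : μ = volume.withDensity (fun x => ENNReal.ofReal (Real.exp (-U x))))
    (hprob : IsProbabilityMeasure μ)
    (f : EuclideanSpace ℝ (Fin n) → ℝ)
    (hf : ContDiff ℝ (⊤ : ℕ∞) f)
    (hfd : ∀ i : ℕ, ∃ C : ℝ, ∀ x, ‖iteratedFDeriv ℝ i f x‖ ≤ C) :
    ∫ x, (f x) ^ 2 * Real.log ((f x) ^ 2) ∂μ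
        - (∫ x, (f x) ^ 2 ∂μ) * Real.log (∫ x, (f x) ^ 2 ∂μ)
      ≤ (2 / R) * ∫ x, ‖fderiv ℝ f x‖ ^ 2 ∂μ := by
  obtain ⟨A, hA⟩ := hfd 0
  obtain ⟨L, hL⟩ := hfd 1
  obtain ⟨M, hM⟩ := hfd 2
  simp only [norm_iteratedFDeriv_zero, Real.norm_eq_abs] at hA
  simp only [norm_iteratedFDeriv_one] at hL
  have hM' : ∀ x, ‖fderiv ℝ (fderiv ℝ f) x‖ ≤ M := fun x => by
    rw [← norm_iteratedFDeriv_one, norm_iteratedFDeriv_fderiv]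
    exact hM x
  have hU2 : ContDiff ℝ 2 U := contDiff_infty.1 hU 2
  have hf2 : ContDiff ℝ 2 f := contDiff_infty.1 hf 2
  have hfc : Continuous f := hf.continuous
  have hsq : ∀ x, |f x ^ 2| ≤ A ^ 2 := fun x => by
    rw [abs_pow]
    gcongr
    exact hA x
  have h1 := tendsto_integral_comp_add (μ := μ) Real.continuous_mul_log (hfc.pow 2) hsq
  have h2 := tendsto_integral_comp_add (μ := μ) continuous_id (hfc.pow 2) hsq
  have h3 := (Real.continuous_mul_log.tendsto _).comp h2
  refine le_of_tendsto (h1.sub h3) ?_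
  filter_upwards [self_mem_nhdsWithin] with ε hε
  exact integral_log_sobolev_sq_add_le hR hU2.continuous
    (strongConvexOn_of_le_fderiv_fderiv hU2 hHess) hμ hf2 hA hL hM' hε
end

section
/- Let Φ(x) = (2π)^{-1/2} ∫_{-∞}^{x} e^{-s²/2} ds be the standard Gaussian cumulative distribution function and let I(x) = Φ'(Φ⁻¹(x)) for x ∈ (0,1). Then I is smooth on (0,1) and satisfies the differential equation I''(x)·I(x) + 1 = 0 for all x ∈ (0,1). -/
open MeasureTheory Real

/-- The standard Gaussian density `Φ'(t) = (2π)^{-1/2} e^{-t²/2}`. -/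
noncomputable def gaussPDF (t : ℝ) : ℝ := Real.exp (-t ^ 2 / 2) / Real.sqrt (2 * Real.pi)

/-- The standard Gaussian cumulative distribution function `Φ`. -/
noncomputable def Phi (x : ℝ) : ℝ := ∫ s in Set.Iic x, gaussPDF s

/-- The inverse `Φ⁻¹` of the Gaussian cdf (on `(0,1)`). -/
noncomputable def PhiInv : ℝ → ℝ := Function.invFun Phi

/-- The Gaussian isoperimetric profile `I = Φ' ∘ Φ⁻¹`. -/
noncomputable def isoI (x : ℝ) : ℝ := gaussPDF (PhiInv x)

open ProbabilityTheory Filter Topology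

theorem gaussPDF_eq_gaussianPDFReal : gaussPDF = gaussianPDFReal 0 1 := by
  ext t
  simp [gaussPDF, gaussianPDFReal, div_eq_inv_mul]

theorem gaussPDF_pos (t : ℝ) : 0 < gaussPDF t := by
  unfold gaussPDF
  positivity

theorem contDiff_gaussPDF {n : WithTop ℕ∞} : ContDiff ℝ n gaussPDF := by
  unfold gaussPDF
  fun_prop

theorem integrable_gaussPDF : Integrable gaussPDF := by
  rw [gaussPDF_eq_gaussianPDFReal]
  exact integrable_gaussianPDFReal 0 1

theorem hasDerivAt_gaussPDF (t : ℝ) : HasDerivAt gaussPDF (-t * gaussPDF t) t := by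
  have h : HasDerivAt (fun s : ℝ => -s ^ 2 / 2) (-t) t :=
    ((hasDerivAt_pow 2 t).fun_neg.div_const 2).congr_deriv (by norm_num; ring)
  refine (h.exp.div_const (√(2 * π))).congr_deriv ?_
  rw [gaussPDF]
  ring

theorem Phi_eq_cdf : Phi = cdf (gaussianReal 0 1) := by
  ext x
  rw [cdf_eq_real, measureReal_def, gaussianReal_apply_eq_integral 0 one_ne_zero,
    ← gaussPDF_eq_gaussianPDFReal, ENNReal.toReal_ofReal, Phi]
  exact integral_nonneg fun t => (gaussPDF_pos t).le

theorem hasDerivAt_Phi (x : ℝ) : HasDerivAt Phi (gaussPDF x) x := by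
  have hint (y : ℝ) : Phi y = Phi 0 + ∫ t in (0 : ℝ)..y, gaussPDF t := by
    rw [← intervalIntegral.integral_Iic_sub_Iic integrable_gaussPDF.integrableOn
      integrable_gaussPDF.integrableOn, Phi, Phi]
    ring
  have hcont : Continuous gaussPDF := (contDiff_gaussPDF (n := 0)).continuous
  rw [funext hint]
  exact (hcont.integral_hasStrictDerivAt 0 x).hasDerivAt.const_add _

theorem contDiff_Phi : ContDiff ℝ (⊤ : ℕ∞) Phi := by
  refine contDiff_infty_iff_deriv.2 ⟨fun x => (hasDerivAt_Phi x).differentiableAt, ?_⟩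
  rw [funext fun x => (hasDerivAt_Phi x).deriv]
  exact contDiff_gaussPDF

theorem strictMono_Phi : StrictMono Phi :=
  strictMono_of_deriv_pos fun x => (hasDerivAt_Phi x).deriv ▸ gaussPDF_pos x

theorem isOpenEmbedding_Phi : IsOpenEmbedding Phi := by
  refine .of_continuous_injective_isOpenMap contDiff_Phi.continuous strictMono_Phi.injective ?_
  exact isOpenMap_of_hasStrictDerivAt (f' := gaussPDF)
    (fun x => contDiff_Phi.contDiffAt.hasStrictDerivAt' (hasDerivAt_Phi x) (by simp))
    fun x => (gaussPDF_pos x).ne'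

theorem Ioo_subset_range_Phi : Set.Ioo 0 1 ⊆ Set.range Phi := by
  intro x hx
  have hbot : Tendsto Phi atBot (𝓝 0) := Phi_eq_cdf ▸ tendsto_cdf_atBot _
  have htop : Tendsto Phi atTop (𝓝 1) := Phi_eq_cdf ▸ tendsto_cdf_atTop _
  obtain ⟨a, ha⟩ := (hbot.eventually_lt_const hx.1).exists
  obtain ⟨b, hb⟩ := (htop.eventually_const_lt hx.2).exists
  exact mem_range_of_exists_le_of_exists_ge contDiff_Phi.continuous ⟨a, ha.le⟩ ⟨b, hb.le⟩

theorem PhiInv_Phi (t : ℝ) : PhiInv (Phi t) = t :=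
  Function.leftInverse_invFun strictMono_Phi.injective t

theorem contDiffAt_PhiInv (t : ℝ) : ContDiffAt ℝ (⊤ : ℕ∞) PhiInv (Phi t) := by
  let e := isOpenEmbedding_Phi.toOpenPartialHomeomorph Phi
  have hsymm (s : ℝ) : e.symm (Phi s) = s := e.left_inv (Set.mem_univ s)
  have he : ContDiffAt ℝ (⊤ : ℕ∞) e.symm (Phi t) := by
    refine e.contDiffAt_symm_deriv (f₀' := gaussPDF t) (gaussPDF_pos t).ne' ?_ ?_ ?_
    · exact e.map_source (Set.mem_univ t)
    · rw [hsymm]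
      exact hasDerivAt_Phi t
    · exact contDiff_Phi.contDiffAt
  refine he.congr_of_eventuallyEq ?_
  filter_upwards [isOpenEmbedding_Phi.isOpen_range.mem_nhds ⟨t, rfl⟩]
  rintro _ ⟨s, rfl⟩
  rw [hsymm, PhiInv_Phi]

theorem hasDerivAt_PhiInv (t : ℝ) : HasDerivAt PhiInv (gaussPDF t)⁻¹ (Phi t) := by
  have hd : HasDerivAt Phi (gaussPDF t) (PhiInv (Phi t)) := by
    rw [PhiInv_Phi]
    exact hasDerivAt_Phi t
  refine hd.of_local_left_inverse (contDiffAt_PhiInv t).continuousAt (gaussPDF_pos t).ne' ?_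
  filter_upwards [isOpenEmbedding_Phi.isOpen_range.mem_nhds ⟨t, rfl⟩]
  rintro _ ⟨s, rfl⟩
  rw [PhiInv_Phi]

theorem deriv_isoI_Phi (t : ℝ) : deriv isoI (Phi t) = -t := by
  have hd : HasDerivAt gaussPDF (-t * gaussPDF t) (PhiInv (Phi t)) := by
    rw [PhiInv_Phi]
    exact hasDerivAt_gaussPDF t
  have h : deriv isoI (Phi t) = -t * gaussPDF t * (gaussPDF t)⁻¹ :=
    (hd.comp (Phi t) (hasDerivAt_PhiInv t)).deriv
  rw [h, mul_inv_cancel_right₀ (gaussPDF_pos t).ne']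

theorem deriv_isoI_eventuallyEq (t : ℝ) : deriv isoI =ᶠ[𝓝 (Phi t)] fun y => -PhiInv y := by
  filter_upwards [isOpenEmbedding_Phi.isOpen_range.mem_nhds ⟨t, rfl⟩]
  rintro _ ⟨s, rfl⟩
  rw [deriv_isoI_Phi, PhiInv_Phi]

/-- the Gaussian isoperimetric profile `I = Φ'∘Φ⁻¹` is smooth on `(0,1)`
and satisfies `I''·I + 1 = 0` there. -/
theorem stmt_6 : ContDiffOn ℝ (⊤ : ℕ∞) isoI (Set.Ioo 0 1) ∧
    ∀ x ∈ Set.Ioo (0 : ℝ) 1, deriv (deriv isoI) x * isoI x + 1 = 0 := by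
  refine ⟨fun x hx => ?_, fun x hx => ?_⟩ <;> obtain ⟨t, rfl⟩ := Ioo_subset_range_Phi hx
  · exact (contDiff_gaussPDF.contDiffAt.comp _ (contDiffAt_PhiInv t)).contDiffWithinAt
  · rw [(deriv_isoI_eventuallyEq t).deriv_eq, (hasDerivAt_PhiInv t).fun_neg.deriv, isoI, PhiInv_Phi,
      neg_mul, inv_mul_cancel₀ (gaussPDF_pos t).ne', neg_add_cancel]
end
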